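/- Let k be a field of characteristic p > 0 and let n be a positive integer. The surjective group homomorphism π : GL_n(W₂(k)) → GL_n(k) admits a group-homomorphism section (a homomorphism s : GL_n(k) → GL_n(W₂(k)) with π ∘ s = id) if and only if one of the following holds: n = 1; or n = 2 and k has at most 3 elements; or n = 3 and k has exactly 2 elements. -/

import Mathlib

open Matrix Topology

/-- The reduction ring homomorphism `π : W₂(k) → k` from the ring of `p`-typical length-`2`
Witt vectors of `k` to `k`, given by the zeroth Witt coefficient. -/
noncomputable def wittReduce (p : ℕ) [hp : Fact p.Prime] (k : Type*) [CommRing k] :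
    TruncatedWittVector p 2 k →+* k where
  toFun x := x.coeff 0
  map_one' := by
    show TruncatedWittVector.coeff 0 (1 : TruncatedWittVector p 2 k) = 1
    rw [show (1 : TruncatedWittVector p 2 k) = WittVector.truncate 2 (1 : WittVector p k) from
        (_root_.map_one _).symm, WittVector.coeff_truncate]
    simpa using WittVector.one_coeff_zero p k
  map_mul' x y := by
    show TruncatedWittVector.coeff 0 (x * y)
        = TruncatedWittVector.coeff 0 x * TruncatedWittVector.coeff 0 y
    obtain ⟨a, ha⟩ := WittVector.truncate_surjective (p := p) 2 k x
    obtain ⟨b, hb⟩ := WittVector.truncate_surjective (p := p) 2 k y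
    rw [← ha, ← hb, ← _root_.map_mul, WittVector.coeff_truncate, WittVector.coeff_truncate,
      WittVector.coeff_truncate]
    simpa using WittVector.mul_coeff_zero a b
  map_zero' := by
    show TruncatedWittVector.coeff 0 (0 : TruncatedWittVector p 2 k) = 0
    rw [show (0 : TruncatedWittVector p 2 k) = WittVector.truncate 2 (0 : WittVector p k) from
        (_root_.map_zero _).symm, WittVector.coeff_truncate]
    simpa using WittVector.zero_coeff p k 0
  map_add' x y := by
    show TruncatedWittVector.coeff 0 (x + y)
        = TruncatedWittVector.coeff 0 x + TruncatedWittVector.coeff 0 y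
    obtain ⟨a, ha⟩ := WittVector.truncate_surjective (p := p) 2 k x
    obtain ⟨b, hb⟩ := WittVector.truncate_surjective (p := p) 2 k y
    rw [← ha, ← hb, ← _root_.map_add, WittVector.coeff_truncate, WittVector.coeff_truncate,
      WittVector.coeff_truncate]
    simpa using WittVector.add_coeff_zero a b

section LiftThreeTwo

/-- Truth tables of the second binary digits of the entries of a lift `GL₃(𝔽₂) → GL₃(ℤ/4)`, where
matrices over `𝔽₂` are enumerated by reading their entries as the binary digits of a number. -/
def secondDigitTable : Matrix (Fin 3) (Fin 3) ℕ :=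
  !![6617115064624770792923647677227373225481302017475894833885760988853581826072163482229172211060596454312807284622401838327558495477321260310252111265792,
     10645113804884326481347524355881196737966132450392503682718251302368638241178819558295857426336355379865857515521996391219649289691612899301925949800448,
     9022821833669053069782819976530624721242320499491387093958107429176605788632446878328458176715328291071325820866887138734831014969116916644655243722752;
     8202763487593044711706173471853716625411611806629765493406914997743107718222405390160738602196595560429936853077242443560649833299903516957616113713152,
     7422882021918414617537797391660289774439272408192088359580841390581515769768471834955129027861901090773009214524379110135226115038222840247670315941888,
     7384516100739147549652653362281679035264273941129580501256240418713989661570377036953174329633449164662041557161577515392425556787061242971517838426112;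
     2512882787094688109860189666236730027984594854575846353613430227163432856813991750698998171277540640285360003971370175822682600545853925075557130698752,
     4155691571811441045904183842540689702933239689222808050400866058652985470023204703485809889773519571037117491163320061527732889612218432029471904104448,
     8198074234002238465716337437293399351972995797170391040374763155323073393451297729216377399210384405862345190999146982848847732840707258832365564198912]

/-- The `b`-th entry of the `a`-th row of the matrix over `𝔽₂` whose `i`-th row has binary
code `r i`. -/
def bitEntry (r : Fin 3 → ℕ) (a b : Fin 3) : ℕ := (r a >>> b.val) % 2

/-- The permanent of the matrix over `𝔽₂` whose `i`-th row has binary code `r i`. -/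
def bitPermanent (r : Fin 3 → ℕ) : ℕ :=
  bitEntry r 0 0 * bitEntry r 1 1 * bitEntry r 2 2 +
    bitEntry r 0 0 * bitEntry r 1 2 * bitEntry r 2 1 +
    bitEntry r 0 1 * bitEntry r 1 0 * bitEntry r 2 2 +
    bitEntry r 0 1 * bitEntry r 1 2 * bitEntry r 2 0 +
    bitEntry r 0 2 * bitEntry r 1 0 * bitEntry r 2 1 +
    bitEntry r 0 2 * bitEntry r 1 1 * bitEntry r 2 0

/-- The entries of the lift to `ℤ/4` of the matrix over `𝔽₂` whose `i`-th row has binary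
code `r i`. -/
def liftedEntry (r : Fin 3 → ℕ) (a b : Fin 3) : ℕ :=
  bitEntry r a b + 2 * ((secondDigitTable a b >>> (r 0 + 8 * r 1 + 64 * r 2)) % 2)

/-- The effect on row codes of adding row `j` to row `i`. -/
def addRow (i j : Fin 3) (r : Fin 3 → ℕ) : Fin 3 → ℕ := Function.update r i (r i ^^^ r j)

set_option synthInstance.maxSize 1000 in
theorem liftedEntry_addRow : ∀ r₀ < 8, ∀ r₁ < 8, ∀ r₂ < 8,
    bitPermanent ![r₀, r₁, r₂] % 2 = 1 →
    ∀ i j : Fin 3, i ≠ j → ∀ a b, liftedEntry (addRow i j ![r₀, r₁, r₂]) a b % 4 =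
      (liftedEntry (addRow i j ![1, 2, 4]) a 0 * liftedEntry ![r₀, r₁, r₂] 0 b +
        liftedEntry (addRow i j ![1, 2, 4]) a 1 * liftedEntry ![r₀, r₁, r₂] 1 b +
        liftedEntry (addRow i j ![1, 2, 4]) a 2 * liftedEntry ![r₀, r₁, r₂] 2 b) % 4 := by
  decide +kernel

/-- The binary code of a vector over `𝔽₂`. -/
def rowCode (u : Fin 3 → ZMod 2) : ℕ := (u 0).val + 2 * (u 1).val + 4 * (u 2).val

theorem rowCode_add : ∀ u v, rowCode (u + v) = rowCode u ^^^ rowCode v := by decide +kernel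

theorem rowCode_lt : ∀ u, rowCode u < 8 := by decide +kernel

theorem natCast_rowCode_shiftRight :
    ∀ u (b : Fin 3), (((rowCode u >>> b.val) % 2 : ℕ) : ZMod 2) = u b := by decide +kernel

/-- The binary codes of the rows of a matrix over `𝔽₂`. -/
def rowCodes (g : Matrix (Fin 3) (Fin 3) (ZMod 2)) : Fin 3 → ℕ :=
  ![rowCode (g.row 0), rowCode (g.row 1), rowCode (g.row 2)]

theorem rowCodes_apply (g : Matrix (Fin 3) (Fin 3) (ZMod 2)) (a : Fin 3) :
    rowCodes g a = rowCode (g.row a) := by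
  fin_cases a <;> rfl

theorem rowCodes_one : rowCodes 1 = ![1, 2, 4] := by
  decide +kernel

theorem natCast_bitEntry_rowCodes (g : Matrix (Fin 3) (Fin 3) (ZMod 2)) (a b : Fin 3) :
    (bitEntry (rowCodes g) a b : ZMod 2) = g a b := by
  rw [bitEntry, rowCodes_apply, natCast_rowCode_shiftRight, row_apply]

theorem rowCodes_transvection_mul (i j : Fin 3) (g : Matrix (Fin 3) (Fin 3) (ZMod 2)) :
    rowCodes (transvection i j 1 * g) = addRow i j (rowCodes g) := by
  funext a
  rw [rowCodes_apply, addRow, rowCodes_apply, rowCodes_apply]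
  rcases eq_or_ne a i with rfl | ha
  · rw [Function.update_self, ← rowCode_add]
    congr 1
    funext b
    simp
  · rw [Function.update_of_ne ha, rowCodes_apply]
    congr 1
    funext b
    simp [ha]

/-- A function whose restriction to `GL₃(𝔽₂)` is a multiplicative lift to `GL₃(ℤ/4)`. -/
def liftThreeTwo (g : Matrix (Fin 3) (Fin 3) (ZMod 2)) : Matrix (Fin 3) (Fin 3) (ZMod (2 ^ 2)) :=
  of fun a b => (liftedEntry (rowCodes g) a b : ZMod (2 ^ 2))

theorem castHom_liftThreeTwo (g : Matrix (Fin 3) (Fin 3) (ZMod 2)) (i j : Fin 3) :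
    ZMod.castHom (dvd_pow_self 2 two_ne_zero) (ZMod 2) (liftThreeTwo g i j) = g i j := by
  rw [liftThreeTwo, of_apply, map_natCast, liftedEntry, Nat.cast_add, natCast_bitEntry_rowCodes,
    Nat.cast_mul, show ((2 : ℕ) : ZMod 2) = 0 from rfl, zero_mul, add_zero]

theorem liftThreeTwo_one : liftThreeTwo 1 = 1 := by decide +kernel

theorem liftThreeTwo_transvection_mul {i j : Fin 3} (hij : i ≠ j)
    (g : Matrix (Fin 3) (Fin 3) (ZMod 2)) (hg : g.det ≠ 0) :
    liftThreeTwo (transvection i j 1 * g) =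
      liftThreeTwo (transvection i j 1) * liftThreeTwo g := by
  have hT : rowCodes (transvection i j 1) = addRow i j ![1, 2, 4] := by
    rw [← rowCodes_one, ← rowCodes_transvection_mul, mul_one]
  have hdet : bitPermanent (rowCodes g) % 2 = 1 := by
    rw [← Nat.odd_iff, ← ZMod.natCast_ne_zero_iff_odd]
    simp only [bitPermanent, Nat.cast_add, Nat.cast_mul, natCast_bitEntry_rowCodes]
    simpa only [det_fin_three, CharTwo.sub_eq_add] using hg
  ext a b
  rw [mul_apply, Fin.sum_univ_three]
  simp only [liftThreeTwo, of_apply, rowCodes_transvection_mul, hT]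
  exact_mod_cast (ZMod.natCast_eq_natCast_iff' _ _ (2 ^ 2)).2 (liftedEntry_addRow _ (rowCode_lt _) _
    (rowCode_lt _) _ (rowCode_lt _) hdet i j hij a b)

end LiftThreeTwo

section LiftTwoTwo

/-- A function whose restriction to `GL₂(𝔽₂)` is a multiplicative lift to `GL₂(ℤ/4)`. -/
def liftTwoTwo (g : Matrix (Fin 2) (Fin 2) (ZMod 2)) : Matrix (Fin 2) (Fin 2) (ZMod (2 ^ 2)) :=
  of fun i j => (((g i j).val + 2 * ((g 0 j).val * (g 1 j).val) : ℕ) : ZMod (2 ^ 2))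

theorem castHom_liftTwoTwo (g : Matrix (Fin 2) (Fin 2) (ZMod 2)) (i j : Fin 2) :
    ZMod.castHom (dvd_pow_self 2 two_ne_zero) (ZMod 2) (liftTwoTwo g i j) = g i j := by
  rw [liftTwoTwo, of_apply, map_natCast, Nat.cast_add, ZMod.natCast_zmod_val, Nat.cast_mul,
    show ((2 : ℕ) : ZMod 2) = 0 from rfl, zero_mul, add_zero]

theorem liftTwoTwo_one : liftTwoTwo 1 = 1 := by decide +kernel

theorem liftTwoTwo_transvection_mul : ∀ i j, i ≠ j → ∀ g : Matrix (Fin 2) (Fin 2) (ZMod 2),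
    g.det ≠ 0 → liftTwoTwo (transvection i j 1 * g) =
      liftTwoTwo (transvection i j 1) * liftTwoTwo g := by
  decide +kernel

end LiftTwoTwo

section LiftTwoThree

/-- The Teichmüller lift `𝔽₃ → ℤ/9`. -/
def teichmullerThree (x : ZMod 3) : ZMod (3 ^ 2) := (x.val : ZMod (3 ^ 2)) ^ 3

/-- A function whose restriction to `GL₂(𝔽₃)` is a multiplicative lift to `GL₂(ℤ/9)`, in terms of
the Teichmüller lifts of the entries. -/
def liftTwoThreeAux (a b c d : ZMod (3 ^ 2)) : Matrix (Fin 2) (Fin 2) (ZMod (3 ^ 2)) :=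
  !![a + 3 * (2 * b * c * d + a * (c ^ 2 * d ^ 2 + b ^ 2 * d ^ 2 + 2 * b ^ 2 * c ^ 2)),
      b + 3 * (2 * a * c * d + b * (c ^ 2 * d ^ 2 + 2 * a ^ 2 * d ^ 2 + a ^ 2 * c ^ 2));
    c + 3 * (2 * a * b * d + c * (b ^ 2 * d ^ 2 + 2 * a ^ 2 * d ^ 2 + a ^ 2 * b ^ 2)),
      d + 3 * (2 * a * b * c + d * (2 * b ^ 2 * c ^ 2 + a ^ 2 * c ^ 2 + a ^ 2 * b ^ 2))]

/-- A function whose restriction to `GL₂(𝔽₃)` is a multiplicative lift to `GL₂(ℤ/9)`. -/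
def liftTwoThree (g : Matrix (Fin 2) (Fin 2) (ZMod 3)) : Matrix (Fin 2) (Fin 2) (ZMod (3 ^ 2)) :=
  liftTwoThreeAux (teichmullerThree (g 0 0)) (teichmullerThree (g 0 1)) (teichmullerThree (g 1 0))
    (teichmullerThree (g 1 1))

theorem castHom_liftTwoThree (g : Matrix (Fin 2) (Fin 2) (ZMod 3)) (i j : Fin 2) :
    ZMod.castHom (dvd_pow_self 3 two_ne_zero) (ZMod 3) (liftTwoThree g i j) = g i j := by
  have h3 : ZMod.castHom (dvd_pow_self 3 two_ne_zero) (ZMod 3) 3 = 0 := by decide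
  have ht : ∀ x, ZMod.castHom (dvd_pow_self 3 two_ne_zero) (ZMod 3) (teichmullerThree x) = x := by
    decide
  fin_cases i <;> fin_cases j <;> simp [liftTwoThree, liftTwoThreeAux, -ZMod.castHom_apply, h3, ht]

theorem liftTwoThree_one : liftTwoThree 1 = 1 := by decide +kernel

theorem liftTwoThree_transvection_mul {i j : Fin 2} (hij : i ≠ j) (x : ZMod 3)
    (g : Matrix (Fin 2) (Fin 2) (ZMod 3)) (hg : g.det ≠ 0) :
    liftTwoThree (transvection i j x * g) = liftTwoThree (transvection i j x) * liftTwoThree g := by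
  rw [eta_fin_two g] at hg ⊢
  generalize g 0 0 = a, g 0 1 = b, g 1 0 = c, g 1 1 = d at hg ⊢
  rw [det_fin_two_of] at hg
  revert i j x a b c d
  decide +kernel

theorem liftTwoThree_diagonal_mul (D : Fin 2 → ZMod 3) (hD : (diagonal D).det ≠ 0)
    (g : Matrix (Fin 2) (Fin 2) (ZMod 3)) (hg : g.det ≠ 0) :
    liftTwoThree (diagonal D * g) = liftTwoThree (diagonal D) * liftTwoThree g := by
  rw [eta_fin_two g] at hg ⊢
  generalize g 0 0 = a, g 0 1 = b, g 1 0 = c, g 1 1 = d at hg ⊢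
  rw [det_fin_two_of] at hg
  rw [det_diagonal, Fin.prod_univ_two] at hD
  revert D a b c d
  decide +kernel

end LiftTwoThree

/-- A function that is multiplicative for left multiplication by diagonal matrices and
transvections is multiplicative on invertible matrices. -/
theorem map_mul_of_map_diagonal_mul_of_map_transvection_mul {m : Type*} [Fintype m] [DecidableEq m]
    {K M : Type*} [Field K] [Semigroup M] (F : Matrix m m K → M)
    (hdiag : ∀ D : m → K, (diagonal D).det ≠ 0 → ∀ g : Matrix m m K, g.det ≠ 0 →
      F (diagonal D * g) = F (diagonal D) * F g)
    (htrans : ∀ i j, i ≠ j → ∀ x, ∀ g : Matrix m m K, g.det ≠ 0 →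
      F (transvection i j x * g) = F (transvection i j x) * F g)
    (f g : Matrix m m K) (hf : f.det ≠ 0) (hg : g.det ≠ 0) : F (f * g) = F f * F g := by
  revert g
  refine diagonal_transvection_induction_of_det_ne_zero
    (fun f => ∀ g : Matrix m m K, g.det ≠ 0 → F (f * g) = F f * F g) f hf hdiag
    (fun t => htrans t.i t.j t.hij t.c) fun A B hA hB ihA ihB g hg => ?_
  rw [Matrix.mul_assoc, ihA _ (by simp [hB, hg]), ihB g hg, ihA B hB, mul_assoc]

/-- A multiplicative lift of `GL_m(𝔽_p)` to `GL_m(ℤ/p²)` gives a multiplicative lift of `GL_m(k)` to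
`GL_m(R)`, for `k` a field with `p` elements and `R → k` a ring homomorphism with `p² = 0` in
`R`. -/
theorem exists_section_of_lift {m : Type*} [Fintype m] [DecidableEq m] {R k : Type*} [CommRing R]
    [Field k] (π : R →+* k) {p : ℕ} [Fact p.Prime] (e : k ≃+* ZMod p) (hR : ((p ^ 2 : ℕ) : R) = 0)
    (F : Matrix m m (ZMod p) → Matrix m m (ZMod (p ^ 2))) (hone : F 1 = 1)
    (hF : ∀ g i j, ZMod.castHom (dvd_pow_self p two_ne_zero) (ZMod p) (F g i j) = g i j)
    (hdiag : ∀ D : m → ZMod p, (diagonal D).det ≠ 0 → ∀ g : Matrix m m (ZMod p), g.det ≠ 0 →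
      F (diagonal D * g) = F (diagonal D) * F g)
    (htrans : ∀ i j, i ≠ j → ∀ x, ∀ g : Matrix m m (ZMod p), g.det ≠ 0 →
      F (transvection i j x * g) = F (transvection i j x) * F g) :
    ∃ s : GL m k →* GL m R, (Matrix.GeneralLinearGroup.map π).comp s = MonoidHom.id (GL m k) := by
  obtain ⟨q, hq⟩ := CharP.exists R
  let φ : ZMod (p ^ 2) →+* R := ZMod.castHom ((CharP.cast_eq_zero_iff R q _).1 hR) R
  have hφ : π.comp φ =
      (e.symm : ZMod p →+* k).comp (ZMod.castHom (dvd_pow_self p two_ne_zero) (ZMod p)) :=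
    Subsingleton.elim _ _
  have hdet (g : GL m (ZMod p)) : g.val.det ≠ 0 :=
    ((isUnit_iff_isUnit_det g.val).1 g.isUnit).ne_zero
  let G : GL m (ZMod p) →* Matrix m m (ZMod (p ^ 2)) :=
    { toFun := fun g => F g.val
      map_one' := hone
      map_mul' := fun f g => map_mul_of_map_diagonal_mul_of_map_transvection_mul F hdiag htrans _ _
        (hdet f) (hdet g) }
  refine ⟨(Matrix.GeneralLinearGroup.map φ).comp
    (G.toHomUnits.comp (Matrix.GeneralLinearGroup.map (e : k →+* ZMod p))), ?_⟩
  ext g i j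
  change π.comp φ (F _ i j) = g.val i j
  rw [hφ, RingHom.comp_apply, hF]
  simp

/-- Reduction of `1 × 1` matrices has a multiplicative section if reduction of scalars has. -/
theorem exists_section_fin_one {R k : Type*} [CommRing R] [CommRing k] (π : R →+* k) (τ : k →* R)
    (hτ : ∀ x, π (τ x) = x) :
    ∃ s : GL (Fin 1) k →* GL (Fin 1) R,
      (Matrix.GeneralLinearGroup.map π).comp s = MonoidHom.id (GL (Fin 1) k) := by
  let T : Matrix (Fin 1) (Fin 1) k →* Matrix (Fin 1) (Fin 1) R :=
    { toFun := fun M => of fun _ _ => τ (M 0 0)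
      map_one' := by ext i j; rw [Subsingleton.elim i j]; simp
      map_mul' := fun M N => by ext i j; simp [mul_apply] }
  refine ⟨Units.map T, ?_⟩
  ext g i j
  change π (τ (g.val 0 0)) = g.val i j
  rw [hτ, Subsingleton.elim i 0, Subsingleton.elim j 0]

/-- Over a field with two elements it suffices to check multiplicativity for transvections. -/
theorem exists_section_of_lift_two {m : Type*} [Fintype m] [DecidableEq m] {R k : Type*}
    [CommRing R] [Field k] (π : R →+* k) (e : k ≃+* ZMod 2) (hR : ((2 ^ 2 : ℕ) : R) = 0)
    (F : Matrix m m (ZMod 2) → Matrix m m (ZMod (2 ^ 2))) (hone : F 1 = 1)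
    (hF : ∀ g i j, ZMod.castHom (dvd_pow_self 2 two_ne_zero) (ZMod 2) (F g i j) = g i j)
    (htrans : ∀ i j, i ≠ j → ∀ g : Matrix m m (ZMod 2), g.det ≠ 0 →
      F (transvection i j 1 * g) = F (transvection i j 1) * F g) :
    ∃ s : GL m k →* GL m R, (Matrix.GeneralLinearGroup.map π).comp s = MonoidHom.id (GL m k) := by
  refine exists_section_of_lift π e hR F hone hF (fun D hD g _ => ?_) (fun i j hij x g hg => ?_)
  · have : D = fun _ => 1 := by
      funext i
      refine Fin.eq_one_of_ne_zero _ fun h => hD ?_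
      rw [det_diagonal]
      exact Finset.prod_eq_zero (Finset.mem_univ i) h
    rw [this, diagonal_one, hone, one_mul, one_mul]
  · obtain rfl | rfl : x = 0 ∨ x = 1 := by revert x; decide
    · rw [transvection_zero, hone, one_mul, one_mul]
    · exact htrans i j hij g hg

section Obstruction

theorem one_add_pow_prime_of_pow_four_eq_zero {S : Type*} [Ring S] {p : ℕ} (hp : p.Prime)
    (h5 : 5 ≤ p) {x : S} (hx : x ^ 4 = 0) (hpx : (p : S) * x ^ 2 = 0) :
    (1 + x) ^ p = 1 + p * x := by
  obtain ⟨q, rfl⟩ : ∃ q, p = q + 1 := ⟨p - 1, by omega⟩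
  rw [add_comm 1 x, (Commute.one_right x).add_pow, Finset.sum_range_succ', Finset.sum_range_succ',
    Finset.sum_eq_zero]
  · simp only [zero_add, pow_one, one_pow, mul_one, Nat.choose_one_right, pow_zero,
      Nat.choose_zero_right, Nat.cast_one]
    rw [add_comm, Nat.cast_comm]
  · intro i _
    rw [one_pow, mul_one]
    obtain hi | hi := le_or_gt 4 (i + 1 + 1)
    · rw [pow_eq_zero_of_le hi hx, zero_mul]
    · obtain ⟨c, hc⟩ := hp.dvd_choose_self (k := i + 1 + 1) (by omega) (by omega)
      have hpx' : x ^ 2 * ((q + 1 : ℕ) : S) = 0 := by rw [← Nat.cast_comm, hpx]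
      rw [hc, Nat.cast_mul, ← mul_assoc, add_assoc, pow_add, mul_assoc (x ^ i), hpx', mul_zero,
        zero_mul]

theorem Matrix.mul_eq_zero_of_map_eq_zero {m R k : Type*} [Fintype m] [CommRing R] [CommRing k]
    {π : R →+* k} (hπ : ∀ x y, π x = 0 → π y = 0 → x * y = 0) {P Q : Matrix m m R}
    (hP : P.map π = 0) (hQ : Q.map π = 0) : P * Q = 0 := by
  ext i j
  rw [mul_apply, zero_apply]
  exact Finset.sum_eq_zero fun l _ => hπ _ _ (congrFun₂ hP i l) (congrFun₂ hQ l j)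

variable {m : Type*} [Fintype m] [DecidableEq m] {R k : Type*} [CommRing R] [Field k]

theorem Matrix.natCast_mul_apply (c : ℕ) (A : Matrix m m R) (i j : m) :
    ((c : Matrix m m R) * A) i j = c * A i j := by
  rw [← nsmul_eq_mul, Matrix.smul_apply, nsmul_eq_mul]

/-- The unit `1 + N` for a matrix `N` of square zero. -/
def unipotentUnit (N : Matrix m m k) (hN : N * N = 0) : GL m k where
  val := 1 + N
  inv := 1 - N
  val_inv := by rw [(Commute.one_left N).mul_self_sub_mul_self_eq.symm, hN]; simp
  inv_val := by rw [(Commute.one_left N).mul_self_sub_mul_self_eq'.symm, hN]; simp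

/-- A choice, for every matrix `A` of square zero, of a perturbation `1 + A + P A` of `1 + A` of
order dividing `p`, in such a way that the perturbations attached to matrices with vanishing
products commute; the perturbing terms are killed by `p` and by one another. -/
structure IsPerturbation (p : ℕ) (P : Matrix m m R → Matrix m m R) : Prop where
  natCast_mul : ∀ A i j, (p : R) * P A i j = 0
  mul_mul : ∀ A X B, P A * X * P B = 0
  pow_eq_one : ∀ A, A * A = 0 → (1 + A + P A) ^ p = 1
  comm : ∀ A B, A * A = 0 → B * B = 0 → A * B = 0 → B * A = 0 →
    A * P B + P A * B = B * P A + P B * A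

theorem exists_isPerturbation {p : ℕ} [Fact p.Prime] [CharP k p] [Nonempty m] {π : R →+* k}
    (hπ : ∀ x y, π x = 0 → π y = 0 → x * y = 0) {s : GL m k →* GL m R}
    (hs : (Matrix.GeneralLinearGroup.map π).comp s = MonoidHom.id (GL m k)) :
    ∃ P : Matrix m m R → Matrix m m R, IsPerturbation p P := by
  classical
  have hmap {A B : Matrix m m R} (h : A * B = 0) : A.map π * B.map π = 0 := by
    rw [← Matrix.map_mul, h, Matrix.map_zero _ (map_zero π)]
  let P : Matrix m m R → Matrix m m R := fun A =>
    if h : A * A = 0 then (s (unipotentUnit (A.map π) (hmap h))).val - (1 + A) else 0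
  have hP : ∀ A (h : A * A = 0), 1 + A + P A = (s (unipotentUnit (A.map π) (hmap h))).val := by
    intro A h
    simp [P, h]
  have hker : ∀ A, (P A).map π = 0 := by
    intro A
    by_cases h : A * A = 0
    · have h1 := congrArg Units.val (DFunLike.congr_fun hs (unipotentUnit (A.map π) (hmap h)))
      have h2 : (s (unipotentUnit (A.map π) (hmap h))).val.map π = 1 + A.map π := h1
      rw [← hP A h, Matrix.map_add _ (map_add π), Matrix.map_add _ (map_add π),
        Matrix.map_one _ (map_zero π) (map_one π)] at h2
      simpa using h2
    · simp [P, h]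
  refine ⟨P, fun A i j => ?_, fun A X B => ?_, fun A h => ?_, fun A B hA hB hAB hBA => ?_⟩
  · exact hπ _ _ (by simp) (congrFun₂ (hker A) i j)
  · exact mul_eq_zero_of_map_eq_zero hπ (by rw [Matrix.map_mul, hker, Matrix.zero_mul]) (hker B)
  · rw [hP A h, ← Units.val_pow_eq_pow_val, ← map_pow, ← Units.val_one, ← map_one s]
    congr 2
    ext1
    have hz : (A.map π) ^ p = 0 := pow_eq_zero_of_le (Fact.out : p.Prime).two_le
      (by rw [pow_two, hmap h])
    have : (1 + A.map π) ^ p = 1 := by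
      rw [add_pow_char_of_commute (p := p) (Commute.one_left _), hz, one_pow, add_zero]
    exact this
  · have hcomm : (1 + A + P A) * (1 + B + P B) = (1 + B + P B) * (1 + A + P A) := by
      rw [hP A hA, hP B hB, ← Units.val_mul, ← Units.val_mul, ← map_mul, ← map_mul]
      congr 2
      ext1
      change (1 + A.map π) * (1 + B.map π) = (1 + B.map π) * (1 + A.map π)
      simp only [mul_add, add_mul, hmap hAB, hmap hBA, mul_one, one_mul]
      abel
    have hPQ : P A * P B = 0 := mul_eq_zero_of_map_eq_zero hπ (hker A) (hker B)
    have hQP : P B * P A = 0 := mul_eq_zero_of_map_eq_zero hπ (hker B) (hker A)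
    rw [← sub_eq_zero] at hcomm ⊢
    calc _ = (1 + A + P A) * (1 + B + P B) - (1 + B + P B) * (1 + A + P A) -
          (A * B - B * A) - (P A * P B - P B * P A) := by noncomm_ring
      _ = 0 := by simp [hcomm, hAB, hBA, hPQ, hQP]

namespace IsPerturbation

variable {P : Matrix m m R → Matrix m m R}

theorem natCast_mul_matrix {p : ℕ} (h : IsPerturbation p P) (A : Matrix m m R) :
    (p : Matrix m m R) * P A = 0 := by
  ext i j
  rw [natCast_mul_apply, h.natCast_mul, Matrix.zero_apply]

theorem mul_self {p : ℕ} (h : IsPerturbation p P) (A B : Matrix m m R) : P A * P B = 0 := by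
  simpa using h.mul_mul A 1 B

theorem natCast_mul_eq_zero {p : ℕ} (h : IsPerturbation p P) (hp : p.Prime) (h5 : 5 ≤ p)
    {A : Matrix m m R} (hA : A * A = 0) : (p : Matrix m m R) * A = 0 := by
  have h0 : P A * A * P A = 0 := h.mul_mul A A A
  have h1 : P A * P A = 0 := h.mul_self A A
  have h2 : (A + P A) ^ 2 = A * P A + P A * A := by
    rw [pow_two]; simp [mul_add, add_mul, hA, h1, add_comm]
  have h4 : (A + P A) ^ 4 = 0 := by
    rw [show 4 = 2 + 2 from rfl, pow_add, h2]
    calc _ = A * (P A * A * P A) + A * (P A * P A) * A + P A * (A * A) * P A +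
          P A * A * P A * A := by noncomm_ring
      _ = 0 := by simp [h0, h1, hA]
  have hp2 : (p : Matrix m m R) * (A + P A) ^ 2 = 0 := by
    rw [h2, mul_add, ← mul_assoc, ← mul_assoc, h.natCast_mul_matrix, Nat.cast_comm, mul_assoc,
      h.natCast_mul_matrix]
    simp
  have := one_add_pow_prime_of_pow_four_eq_zero hp h5 h4 hp2
  rw [← add_assoc, h.pow_eq_one A hA] at this
  simpa [mul_add, h.natCast_mul_matrix] using this

theorem cube_relation (h : IsPerturbation 3 P) {A : Matrix m m R} (hA : A * A = 0) (i j : m) :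
    3 * A i j + (A * P A * A) i j = 0 := by
  have h1 := h.pow_eq_one A hA
  have h3 : 3 * P A = 0 := h.natCast_mul_matrix A
  have key : 3 * A + A * P A * A = 0 := by
    rw [← sub_eq_zero] at h1
    calc _ = (1 + A + P A) ^ 3 - 1 - 3 * P A - (A * A) * (3 + A + P A) - P A * (A * A)
          - (A * (3 * P A)) - 3 * P A * A - P A * P A * (3 + A + P A) - A * (P A * P A)
          - P A * A * P A := by noncomm_ring
      _ = 0 := by simp [h1, h3, hA, h.mul_self, h.mul_mul]
  have := congrFun₂ key i j
  rwa [Matrix.add_apply, Matrix.zero_apply, ← Nat.cast_ofNat, natCast_mul_apply] at this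

theorem square_relation (h : IsPerturbation 2 P) {A : Matrix m m R} (hA : A * A = 0) (i j : m) :
    2 * A i j + (A * P A) i j + (P A * A) i j = 0 := by
  have h1 := h.pow_eq_one A hA
  have h3 : 2 * P A = 0 := h.natCast_mul_matrix A
  have key : 2 * A + A * P A + P A * A = 0 := by
    rw [← sub_eq_zero] at h1
    calc _ = (1 + A + P A) ^ 2 - 1 - 2 * P A - A * A - P A * P A := by noncomm_ring
      _ = 0 := by simp [h1, h3, hA, h.mul_self]
  have := congrFun₂ key i j
  rwa [Matrix.add_apply, Matrix.add_apply, Matrix.zero_apply, ← Nat.cast_ofNat,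
    natCast_mul_apply] at this

theorem comm_apply {p : ℕ} (h : IsPerturbation p P) {A B : Matrix m m R} (hA : A * A = 0)
    (hB : B * B = 0) (hAB : A * B = 0) (hBA : B * A = 0) (i j : m) :
    (A * P B) i j + (P A * B) i j = (B * P A) i j + (P B * A) i j :=
  congrFun₂ (h.comm A B hA hB hAB hBA) i j

theorem three_mul_sub_cube (h : IsPerturbation 3 P) {i j : m} (hij : i ≠ j) (α : R) :
    3 * (α - α ^ 3) = 0 := by
  have h1 := h.cube_relation (A := single i j 1) (by simp [hij.symm]) i j
  have h2 := h.cube_relation (A := single i j α) (by simp [hij.symm]) i j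
  have hc := h.comm_apply (A := single i j α) (B := single i j 1) (by simp [hij.symm])
    (by simp [hij.symm]) (by simp [hij.symm]) (by simp [hij.symm]) i i
  simp only [single_mul_apply_same, mul_single_apply_same, single_apply_same,
    mul_single_apply_of_ne _ _ _ _ _ hij, mul_one, one_mul, add_zero] at h1 h2 hc
  linear_combination h2 - α ^ 3 * h1 + α ^ 2 * hc

theorem three_eq_zero (h : IsPerturbation 3 P) {i j l : m} (hij : i ≠ j) (hil : i ≠ l)
    (hjl : j ≠ l) : (3 : R) = 0 := by
  have hP := h.cube_relation (A := single i j 1) (by simp [hij.symm]) i j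
  have hQ := h.cube_relation (A := single i l 1) (by simp [hil.symm]) i l
  have hR := h.cube_relation (A := single i j 1 + single i l 1)
    (by simp [add_mul, mul_add, hij.symm, hil.symm]) i j
  have hS := h.cube_relation (A := single i j 1 - single i l 1)
    (by simp [sub_mul, mul_sub, hij.symm, hil.symm]) i j
  have hPQ := h.comm_apply (A := single i j 1) (B := single i l 1) (by simp [hij.symm])
    (by simp [hil.symm]) (by simp [hij.symm]) (by simp [hil.symm]) i i
  have hPR := h.comm_apply (A := single i j 1) (B := single i j 1 + single i l 1)
    (by simp [hij.symm])
    (by simp [add_mul, mul_add, hij.symm, hil.symm]) (by simp [mul_add, hij.symm])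
    (by simp [add_mul, hij.symm, hil.symm]) i i
  have hQR := h.comm_apply (A := single i l 1) (B := single i j 1 + single i l 1)
    (by simp [hil.symm])
    (by simp [add_mul, mul_add, hij.symm, hil.symm]) (by simp [mul_add, hil.symm])
    (by simp [add_mul, hij.symm, hil.symm]) i i
  have hPS := h.comm_apply (A := single i j 1) (B := single i j 1 - single i l 1)
    (by simp [hij.symm])
    (by simp [sub_mul, mul_sub, hij.symm, hil.symm]) (by simp [mul_sub, hij.symm])
    (by simp [sub_mul, hij.symm, hil.symm]) i i
  have hQS := h.comm_apply (A := single i l 1) (B := single i j 1 - single i l 1)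
    (by simp [hil.symm])
    (by simp [sub_mul, mul_sub, hij.symm, hil.symm]) (by simp [mul_sub, hil.symm])
    (by simp [sub_mul, hij.symm, hil.symm]) i i
  have h3 := h.natCast_mul (single i j 1) l i
  simp [add_mul, mul_add, sub_mul, mul_sub, hij, hil,
    hjl.symm] at hP hQ hR hS hPQ hPR hQR hPS hQS h3
  linear_combination
    -2 * (hR - hPR - hQR - hP - hQ - hPQ) + (hS - hPS + hQS - hP - hQ + hPQ) + 2 * h3

theorem two_mul_sq_sub (h : IsPerturbation 2 P) {i j : m} (hij : i ≠ j) (α : R) :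
    2 * (α * (α - 1)) = 0 := by
  have h1 := h.square_relation (A := single i j 1) (by simp [hij.symm]) i j
  have h2 := h.square_relation (A := single i j α) (by simp [hij.symm]) i j
  have hc := h.comm_apply (A := single i j α) (B := single i j 1) (by simp [hij.symm])
    (by simp [hij.symm]) (by simp [hij.symm]) (by simp [hij.symm]) i j
  have hP := h.natCast_mul (single i j α) i i
  have hQ := h.natCast_mul (single i j 1) i i
  simp only [single_mul_apply_same, mul_single_apply_same, single_apply_same, Nat.cast_ofNat,
    mul_one, one_mul] at h1 h2 hc hP hQ
  linear_combination α ^ 2 * h1 - α * hc - h2 - α ^ 2 * hQ + α * hP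

theorem two_eq_zero (h : IsPerturbation 2 P) {a b c d : m} (hab : a ≠ b) (hac : a ≠ c)
    (had : a ≠ d) (hbc : b ≠ c) (hbd : b ≠ d) (hcd : c ≠ d) : (2 : R) = 0 := by
  have hsq {i j : m} (hij : i ≠ j) : single i j (1 : R) * single i j 1 = 0 := by simp [hij.symm]
  have h1 := h.square_relation (hsq hac) a c
  have h2 := h.comm_apply (hsq hac) (hsq hbd) (by simp [hbc.symm]) (by simp [had.symm]) b d
  have h3 := h.comm_apply (hsq hac) (hsq had) (by simp [hac.symm]) (by simp [had.symm]) a d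
  have h4 := h.comm_apply (hsq hac) (hsq hbc) (by simp [hbc.symm]) (by simp [hac.symm]) b c
  have h5 := h.comm_apply (hsq had) (hsq hbc) (by simp [hbd.symm]) (by simp [hac.symm]) b d
  have h6 := h.natCast_mul (single a c 1) c c
  have h7 := h.natCast_mul (single b c 1) b a
  simp [hab.symm, hcd.symm] at h1 h2 h3 h4 h5 h6 h7
  linear_combination h1 + h2 - h3 - h4 - h5 - h6 - h7

end IsPerturbation

end Obstruction

section Witt

variable {p : ℕ} [Fact p.Prime] {k : Type*}

theorem wittReduce_truncate [CommRing k] (a : WittVector p k) :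
    wittReduce p k (WittVector.truncate 2 a) = a.coeff 0 :=
  WittVector.coeff_truncate a 0

theorem TruncatedWittVector.mul_eq_zero_of_wittReduce_eq_zero [CommRing k] [CharP k p]
    (x y : TruncatedWittVector p 2 k) (hx : wittReduce p k x = 0) (hy : wittReduce p k y = 0) :
    x * y = 0 := by
  obtain ⟨a, rfl⟩ := WittVector.truncate_surjective (p := p) 2 k x
  obtain ⟨b, rfl⟩ := WittVector.truncate_surjective (p := p) 2 k y
  rw [wittReduce_truncate] at hx hy
  obtain ⟨a, rfl⟩ : ∃ a', a = WittVector.verschiebung^[1] a' :=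
    ⟨_, WittVector.eq_iterate_verschiebung fun i hi => by rwa [Nat.lt_one_iff.1 hi]⟩
  obtain ⟨b, rfl⟩ : ∃ b', b = WittVector.verschiebung^[1] b' :=
    ⟨_, WittVector.eq_iterate_verschiebung fun i hi => by rwa [Nat.lt_one_iff.1 hi]⟩
  rw [← map_mul, WittVector.iterate_verschiebung_mul]
  ext i
  rw [WittVector.coeff_truncate, TruncatedWittVector.coeff_zero]
  fin_cases i
  · exact WittVector.verschiebung_coeff_zero _
  · exact (WittVector.verschiebung_coeff_succ _ 0).trans (WittVector.verschiebung_coeff_zero _)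

theorem TruncatedWittVector.wittReduce_eq_zero_of_natCast_mul [Field k] [CharP k p]
    (x : TruncatedWittVector p 2 k) (hx : (p : TruncatedWittVector p 2 k) * x = 0) :
    wittReduce p k x = 0 := by
  obtain ⟨a, rfl⟩ := WittVector.truncate_surjective (p := p) 2 k x
  rw [wittReduce_truncate]
  have h := congrArg (TruncatedWittVector.coeff 1) hx
  rw [← map_natCast (WittVector.truncate 2), ← map_mul, WittVector.coeff_truncate, mul_comm,
    TruncatedWittVector.coeff_zero] at h
  exact pow_eq_zero_iff (Fact.out : p.Prime).ne_zero |>.1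
    ((WittVector.mul_charP_coeff_succ a 0).symm.trans h)

theorem TruncatedWittVector.natCast_prime_sq [CommRing k] [CharP k p] :
    ((p ^ 2 : ℕ) : TruncatedWittVector p 2 k) = 0 := by
  rw [pow_two, Nat.cast_mul]
  exact mul_eq_zero_of_wittReduce_eq_zero _ _ (by simp) (by simp)

end Witt

section SmallRank

variable {p : ℕ} [Fact p.Prime] {k : Type} [Field k] [CharP k p] {n : ℕ}

/-- Perturbations of matrices over `W₂(k)` exist only in small rank over small fields. -/
theorem small_of_isPerturbation (hn : 2 ≤ n)
    {P : Matrix (Fin n) (Fin n) (TruncatedWittVector p 2 k) →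
      Matrix (Fin n) (Fin n) (TruncatedWittVector p 2 k)}
    (hP : IsPerturbation p P) : (n = 2 ∧ Cardinal.mk k ≤ 3) ∨ (n = 3 ∧ Cardinal.mk k = 2) := by
  have hp : p.Prime := Fact.out
  have hpR : (p : TruncatedWittVector p 2 k) ≠ 0 := fun h => by
    simpa using TruncatedWittVector.wittReduce_eq_zero_of_natCast_mul (p := p) (k := k) 1
      (by rw [h, zero_mul])
  have h01 : (⟨0, by omega⟩ : Fin n) ≠ ⟨1, by omega⟩ := by simp
  have hlift (a : k) : ∃ x, wittReduce p k x = a :=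
    ⟨WittVector.truncate 2 (WittVector.teichmuller p a), by
      rw [wittReduce_truncate, WittVector.teichmuller_coeff_zero]⟩
  obtain h5 | h5 := le_or_gt 5 p
  · refine absurd ?_ hpR
    have := congrFun₂ (hP.natCast_mul_eq_zero hp h5
      (A := single ⟨0, by omega⟩ ⟨1, by omega⟩ 1) (by simp)) ⟨0, by omega⟩ ⟨1, by omega⟩
    rwa [natCast_mul_apply, single_apply_same, mul_one] at this
  obtain rfl | rfl : p = 2 ∨ p = 3 := by
    have := hp.two_le
    interval_cases p <;> first | omega | exact absurd hp (by norm_num)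
  · have hk (a : k) : a * (a - 1) = 0 := by
      obtain ⟨x, rfl⟩ := hlift a
      simpa using TruncatedWittVector.wittReduce_eq_zero_of_natCast_mul _
        (hP.two_mul_sq_sub h01 x)
    have hcard : Cardinal.mk k = 2 := (Cardinal.mk_eq_two_iff' 0).2 ⟨1, one_ne_zero, fun a ha =>
      sub_eq_zero.1 ((mul_eq_zero.1 (hk a)).resolve_left ha)⟩
    have hn4 : n < 4 := by
      by_contra! hn4
      exact hpR <| hP.two_eq_zero (a := ⟨0, by omega⟩) (b := ⟨1, by omega⟩) (c := ⟨2, by omega⟩)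
        (d := ⟨3, by omega⟩) (by simp) (by simp) (by simp) (by simp) (by simp) (by simp)
    obtain rfl | rfl : n = 2 ∨ n = 3 := by omega
    · exact .inl ⟨rfl, hcard.le.trans (by norm_num)⟩
    · exact .inr ⟨rfl, hcard⟩
  · have hk (a : k) : a - a ^ 3 = 0 := by
      obtain ⟨x, rfl⟩ := hlift a
      simpa using TruncatedWittVector.wittReduce_eq_zero_of_natCast_mul _
        (hP.three_mul_sub_cube h01 x)
    have hn3 : n < 3 := by
      by_contra! hn3
      exact hpR <| hP.three_eq_zero (i := ⟨0, by omega⟩) (j := ⟨1, by omega⟩) (l := ⟨2, by omega⟩)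
        (by simp) (by simp) (by simp)
    refine .inl ⟨by omega, ?_⟩
    have hsurj : Function.Surjective (![0, 1, -1] : Fin 3 → k) := fun a => by
      have : a * ((a - 1) * (a + 1)) = 0 := by linear_combination -hk a
      obtain h | h | h := by simpa only [mul_eq_zero] using this
      · exact ⟨0, h.symm⟩
      · exact ⟨1, (sub_eq_zero.1 h).symm⟩
      · exact ⟨2, (eq_neg_of_add_eq_zero_left h).symm⟩
    simpa using Cardinal.mk_le_of_surjective hsurj

end SmallRank

/-- A field of prime cardinality `q` and characteristic `p` has `q = p`, and is isomorphic to
`𝔽_q`. -/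
theorem eq_and_nonempty_ringEquiv_zmod (p : ℕ) [Fact p.Prime] (k : Type*) [Field k] [CharP k p]
    {q : ℕ} (hq : q.Prime) (hk : Nat.card k = q) : q = p ∧ Nonempty (k ≃+* ZMod q) := by
  have : Finite k := Nat.finite_of_card_ne_zero (hk ▸ hq.ne_zero)
  have := Fintype.ofFinite k
  have hc : Fintype.card k = q := by rw [← Nat.card_eq_fintype_card, hk]
  obtain ⟨m, -, hm⟩ := FiniteField.card k p
  have hpq : p ∣ q := by rw [← hc, hm]; exact dvd_pow_self p m.ne_zero
  exact ⟨((Nat.prime_dvd_prime_iff_eq Fact.out hq).1 hpq).symm,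
    ⟨(ZMod.ringEquivOfPrime k hq hc).symm⟩⟩

/-- The surjection `GL_n(W₂(k)) → GL_n(k)` admits a group-homomorphism
section if and only if `n = 1`, or `n = 2` and `|k| ≤ 3`, or `n = 3` and `|k| = 2`. -/
theorem glift_splits_iff
    (p : ℕ) [Fact p.Prime] (k : Type) [Field k] [CharP k p] (n : ℕ) (hn : 0 < n) :
    (∃ s : GL (Fin n) k →* GL (Fin n) (TruncatedWittVector p 2 k),
        (Matrix.GeneralLinearGroup.map (wittReduce p k)).comp s = MonoidHom.id (GL (Fin n) k))
      ↔ (n = 1 ∨ (n = 2 ∧ Cardinal.mk k ≤ 3) ∨ (n = 3 ∧ Cardinal.mk k = 2)) := by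
  constructor
  · rintro ⟨s, hs⟩
    obtain rfl | hn2 : n = 1 ∨ 2 ≤ n := by omega
    · exact .inl rfl
    have : Nonempty (Fin n) := ⟨⟨0, hn⟩⟩
    obtain ⟨P, hP⟩ :=
      exists_isPerturbation TruncatedWittVector.mul_eq_zero_of_wittReduce_eq_zero hs
    exact .inr (small_of_isPerturbation hn2 hP)
  · rintro (rfl | ⟨rfl, hk⟩ | ⟨rfl, hk⟩)
    · exact exists_section_fin_one (wittReduce p k)
        ((WittVector.truncate 2 : WittVector p k →+* _).toMonoidHom.comp
          (WittVector.teichmuller p))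
        fun x => (wittReduce_truncate _).trans (WittVector.teichmuller_coeff_zero p x)
    · have hfin : Finite k := Cardinal.lt_aleph0_iff_finite.1
        (hk.trans_lt (Cardinal.natCast_lt_aleph0 (n := 3)))
      have hcard : Nat.card k ≤ 3 := by
        rw [← Nat.cast_card] at hk
        exact_mod_cast hk
      have hlt : 1 < Nat.card k := Finite.one_lt_card
      obtain h | h : Nat.card k = 2 ∨ Nat.card k = 3 := by omega
      · obtain ⟨rfl, ⟨e⟩⟩ := eq_and_nonempty_ringEquiv_zmod p k Nat.prime_two h
        exact exists_section_of_lift_two _ e TruncatedWittVector.natCast_prime_sq liftTwoTwo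
          liftTwoTwo_one castHom_liftTwoTwo liftTwoTwo_transvection_mul
      · obtain ⟨rfl, ⟨e⟩⟩ := eq_and_nonempty_ringEquiv_zmod p k Nat.prime_three h
        exact exists_section_of_lift _ e TruncatedWittVector.natCast_prime_sq liftTwoThree
          liftTwoThree_one castHom_liftTwoThree liftTwoThree_diagonal_mul
          fun i j hij x g hg => liftTwoThree_transvection_mul hij x g hg
    · have h : Nat.card k = 2 := by simp [Nat.card, hk]
      obtain ⟨rfl, ⟨e⟩⟩ := eq_and_nonempty_ringEquiv_zmod p k Nat.prime_two h
      exact exists_section_of_lift_two _ e TruncatedWittVector.natCast_prime_sq liftThreeTwo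
        liftThreeTwo_one castHom_liftThreeTwo fun i j hij g hg =>
          liftThreeTwo_transvection_mul hij g hg
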